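/- Let k ≥ 2 and let κ be a cardinal. There exist n ≥ 1 and an algebraic k-hypergraph H on ℝⁿ with χ(H) = κ if and only if either 1 ≤ κ ≤ ℵ₀, or κ ≤ 2^{ℵ₀} ≤ κ^{+(k−2)}. -/

import Mathlib

open Cardinal

/-- A hypergraph with vertex type `V` is identified with its set of edges
`E : Set (Set V)`.  It is `κ`-colorable if there is a function from `V` to a
set of cardinality at most `κ` that is not constant on any edge. -/
def HGColorable {V : Type} (E : Set (Set V)) (κ : Cardinal) : Prop :=
  ∃ (α : Type) (φ : V → α), #α ≤ κ ∧ ∀ e ∈ E, ∃ x ∈ e, ∃ y ∈ e, φ x ≠ φ y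

/-- The chromatic number of a hypergraph: the least cardinal `κ` such that it
has a proper `κ`-coloring. -/
noncomputable def chrNum {V : Type} (E : Set (Set V)) : Cardinal :=
  sInf {κ | HGColorable E κ}

/-- `cardSucc κ m = κ^{+m}`, the `m`-fold cardinal successor of `κ`. -/
noncomputable def cardSucc (κ : Cardinal) (m : ℕ) : Cardinal := (Order.succ)^[m] κ

/-- `Q` is a homomorphic image of the set `P` of `d`-tuples: there is a
surjection `f : P → Q` such that `x i = y i` implies `f x i = f y i`. -/
def IsHomImage {d : ℕ} {A : Type} {B : Fin d → Type} (P : Set (Fin d → A))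
    (Q : Set (∀ i, B i)) : Prop :=
  ∃ f : (Fin d → A) → (∀ i, B i),
    Set.MapsTo f P Q ∧ Set.SurjOn f P Q ∧
    ∀ x ∈ P, ∀ y ∈ P, ∀ i, x i = y i → f x i = f y i

/-- The edges of the template hypergraph `L(X, P)` where `X = Π i, B i`:
the `k`-element subsets of the vertex set that are homomorphic images of `P`. -/
def templateEdges (k : ℕ) {d : ℕ} {A : Type} {B : Fin d → Type}
    (P : Set (Fin d → A)) : Set (Set (∀ i, B i)) :=
  {Q | Q.ncard = k ∧ IsHomImage P Q}

/-- `I` is a distinguisher for `P`: any two distinct members of `P` differ at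
some coordinate in `I`. -/
def IsDistinguisher {d : ℕ} {A : Type} (P : Set (Fin d → A)) (I : Finset (Fin d)) : Prop :=
  ∀ x ∈ P, ∀ y ∈ P, x ≠ y → ∃ i ∈ I, x i ≠ y i

/-- `eDim P = e(P)`, the least cardinality of a distinguisher for `P`. -/
noncomputable def eDim {d : ℕ} {A : Type} (P : Set (Fin d → A)) : ℕ :=
  sInf {e | ∃ I : Finset (Fin d), IsDistinguisher P I ∧ I.card = e}

/-- A `d`-dimensional template is simple if for every `m < d` there are
`x, y ∈ P` with `x i = y i` exactly when `i ≠ m`. -/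
def IsSimple {d : ℕ} {A : Type} (P : Set (Fin d → A)) : Prop :=
  ∀ m : Fin d, ∃ x ∈ P, ∃ y ∈ P, ∀ i, (x i = y i ↔ i ≠ m)

/-- The edges of the zero hypergraph of a `(k, n)`-ary real polynomial:
`k`-element subsets `{a_0, …, a_{k-1}}` of `ℝⁿ` with `p(a_0, …, a_{k-1}) = 0`
for some ordering of the elements. -/
def zeroEdges {n k : ℕ} (p : MvPolynomial (Fin k × Fin n) ℝ) :
    Set (Set (Fin n → ℝ)) :=
  {A | ∃ a : Fin k → (Fin n → ℝ), Function.Injective a ∧ A = Set.range a ∧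
        MvPolynomial.eval (fun q => a q.1 q.2) p = 0}

/-- `H₂ = (V₂, E₂)` contains (a copy of) `H₁ = (V₁, E₁)`: some injection
`V₁ → V₂` maps every edge of `H₁` onto an edge of `H₂`. -/
def HGContains {V₁ V₂ : Type} (E₁ : Set (Set V₁)) (E₂ : Set (Set V₂)) : Prop :=
  ∃ f : V₁ → V₂, Function.Injective f ∧ ∀ e ∈ E₁, f '' e ∈ E₂

section Combinatorics

theorem cardSucc_succ (κ : Cardinal) (m : ℕ) : cardSucc κ (m + 1) = Order.succ (cardSucc κ m) :=
  Function.iterate_succ_apply' _ _ _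

theorem cardSucc_succ' (κ : Cardinal) (m : ℕ) : cardSucc κ (m + 1) = cardSucc (Order.succ κ) m :=
  Function.iterate_succ_apply _ _ _

theorem monotone_cardSucc (κ : Cardinal) : Monotone (cardSucc κ) :=
  monotone_nat_of_le_succ fun m => by
    rw [cardSucc_succ]
    exact Order.le_succ _

theorem cardSucc_mono_left {κ μ : Cardinal} (h : κ ≤ μ) (m : ℕ) : cardSucc κ m ≤ cardSucc μ m :=
  Order.succ_mono.iterate m h

theorem le_cardSucc (κ : Cardinal) (m : ℕ) : κ ≤ cardSucc κ m :=
  monotone_cardSucc κ (Nat.zero_le m)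

theorem cardSucc_lt_aleph0 {κ : Cardinal} (h : κ < ℵ₀) (m : ℕ) : cardSucc κ m < ℵ₀ := by
  induction m with
  | zero => exact h
  | succ m ih =>
    rw [cardSucc_succ]
    exact Cardinal.isSuccLimit_aleph0.succ_lt ih

/-- Polarized partition relation: a coloring of a `d`-dimensional box with `κ` colors is constant
on some finite grid of prescribed shape, as soon as the sides have at least `κ^{+d}` elements. -/
theorem exists_monochromatic_grid {κ : Cardinal} (hκ : ℵ₀ ≤ κ) {C : Type} (hC : #C ≤ κ)
    {L : Type} [Finite L] (d : ℕ) {X : Type} (hX : cardSucc κ d ≤ #X) (c : (Fin d → X) → C) :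
    ∃ (g : Fin d → L → X) (r : C), (∀ i, Function.Injective (g i)) ∧
      ∀ u : Fin d → L, c (fun i => g i (u i)) = r := by
  induction d generalizing X with
  | zero =>
    refine ⟨fun i => i.elim0, c default, fun i => i.elim0, fun u => ?_⟩
    congr 1
    exact Subsingleton.elim _ _
  | succ d ih =>
    obtain ⟨Y, hY⟩ := Cardinal.le_mk_iff_exists_set.1 ((monotone_cardSucc κ d.le_succ).trans hX)
    have h₁ : ∀ z : X, ∃ p : (Fin d → L → Y) × C, (∀ i, Function.Injective (p.1 i)) ∧
        ∀ u : Fin d → L, c (Fin.cons z fun i => (p.1 i (u i) : X)) = p.2 := fun z => by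
      obtain ⟨g, r, hg, hr⟩ := ih hY.ge fun y : Fin d → Y => c (Fin.cons z fun i => (y i : X))
      exact ⟨(g, r), hg, hr⟩
    choose p hp₁ hp₂ using h₁
    have hdinf : ℵ₀ ≤ cardSucc κ d := hκ.trans (le_cardSucc κ d)
    have hcard : #((Fin d → L → Y) × C) < #X := by
      refine lt_of_le_of_lt ?_ (lt_of_lt_of_le (Order.lt_succ (cardSucc κ d))
        ((cardSucc_succ κ d).symm.le.trans hX))
      rw [Cardinal.mk_prod, Cardinal.lift_id, Cardinal.lift_id]
      refine Cardinal.mul_le_of_le hdinf ?_ (hC.trans (le_cardSucc κ d))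
      have : #(Fin d → L → Y) = #(Fin d × L → Y) :=
        Cardinal.mk_congr (Equiv.curry _ _ _).symm
      rw [this, ← Cardinal.power_def, hY]
      exact Cardinal.pow_le hdinf (Cardinal.mk_lt_aleph0)
    have : Infinite X := Cardinal.infinite_iff.2 (hdinf.trans
      ((monotone_cardSucc κ d.le_succ).trans hX))
    obtain ⟨q, hq⟩ := Cardinal.exists_infinite_fiber p hcard
    obtain ⟨e⟩ : Nonempty (L ↪ (p ⁻¹' {q} : Set X)) := by
      obtain ⟨n, ⟨f⟩⟩ := Finite.exists_equiv_fin L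
      exact ⟨f.toEmbedding.trans (Fin.valEmbedding.trans (Infinite.natEmbedding _))⟩
    have hpe : ∀ l, p (e l) = q := fun l => (e l).2
    refine ⟨Fin.cons (fun l => (e l : X)) fun i l => (q.1 i l : X), q.2, ?_, fun u => ?_⟩
    · refine Fin.cases ?_ fun i => ?_
      · exact Subtype.val_injective.comp e.injective
      · simp only [Fin.cons_succ]
        refine Subtype.val_injective.comp ?_
        obtain ⟨z⟩ := hq.nonempty
        rw [← (z.2 : p z = q)]
        exact hp₁ _ i
    · refine Eq.trans ?_ ((hp₂ (e (u 0)) fun i => u i.succ).trans (by rw [hpe]))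
      congr 1
      funext i
      refine Fin.cases ?_ (fun i => ?_) i
      · simp
      · simp [hpe]

/-- A finite nonempty family of distinct tuples is separated by fewer coordinates than it has
members. -/
theorem exists_separating_coordinates {ι A : Type} [DecidableEq ι] (P : Finset (ι → A))
    (hP : P.Nonempty) :
    ∃ I : Finset ι, I.card < P.card ∧ ∀ x ∈ P, ∀ y ∈ P, x ≠ y → ∃ i ∈ I, x i ≠ y i := by
  classical
  induction hP using Finset.Nonempty.cons_induction with
  | singleton a => exact ⟨∅, by simp, by simp⟩
  | cons a P ha hP ih =>
    obtain ⟨I, hI, hsep⟩ := ih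
    by_cases h : ∃ b ∈ P, ∀ i ∈ I, a i = b i
    · obtain ⟨b, hb, hab⟩ := h
      obtain ⟨m, hm⟩ : ∃ m, a m ≠ b m := by
        by_contra! h
        exact ha (funext h ▸ hb)
      have key : ∀ y ∈ P, ∃ i ∈ insert m I, a i ≠ y i := fun y hy => by
        by_cases hyb : y = b
        · exact ⟨m, by simp, hyb ▸ hm⟩
        · obtain ⟨i, hi, hne⟩ := hsep b hb y hy (Ne.symm hyb)
          exact ⟨i, by simp [hi], by rwa [hab i hi]⟩
      refine ⟨insert m I, ?_, fun x hx y hy hxy => ?_⟩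
      · rw [Finset.card_cons]
        exact (Finset.card_insert_le m I).trans_lt (by omega)
      · rcases Finset.mem_cons.1 hx with hxa | hx' <;>
          rcases Finset.mem_cons.1 hy with hya | hy'
        · exact absurd (hxa.trans hya.symm) hxy
        · exact hxa ▸ key y hy'
        · obtain ⟨i, hi, hne⟩ := key x hx'
          exact ⟨i, hi, hya ▸ hne.symm⟩
        · obtain ⟨i, hi, hne⟩ := hsep x hx' y hy' hxy
          exact ⟨i, by simp [hi], hne⟩
    · push Not at h
      refine ⟨I, by rw [Finset.card_cons]; omega, fun x hx y hy hxy => ?_⟩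
      rcases Finset.mem_cons.1 hx with hxa | hx' <;>
          rcases Finset.mem_cons.1 hy with hya | hy'
      · exact absurd (hxa.trans hya.symm) hxy
      · exact hxa ▸ h y hy'
      · obtain ⟨i, hi, hne⟩ := h x hx'
        exact ⟨i, hi, hya ▸ hne.symm⟩
      · exact hsep x hx' y hy' hxy

/-- A box of dimension `j + 1` whose sides have at most `κ^{+j}` elements can be colored with `κ`
colors, each color having a direction, so that no line in the direction of a color contains two
points of this color. -/
theorem exists_coloring_with_directions {κ : Cardinal} (hκ : ℵ₀ ≤ κ) (j : ℕ) {X : Type}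
    (hX : #X ≤ cardSucc κ j) :
    ∃ F : (Fin (j + 1) → X) → Fin (j + 1) × κ.out,
      ∀ x y, F x = F y → (∀ i, i ≠ (F x).1 → x i = y i) → x = y := by
  induction j generalizing X with
  | zero =>
    obtain ⟨f⟩ : Nonempty (X ↪ κ.out) := by
      rw [← Cardinal.le_def, Cardinal.mk_out]
      exact hX
    refine ⟨fun x => (0, f (x 0)), fun x y h _ => ?_⟩
    funext i
    rw [Fin.fin_one_eq_zero i]
    exact f.injective (Prod.mk.inj h).2
  | succ j ih =>
    set μ := cardSucc κ (j + 1) with hμ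
    obtain ⟨f⟩ : Nonempty (X ↪ μ.ord.ToType) := by
      rw [← Cardinal.le_def, Cardinal.mk_toType, Cardinal.card_ord]
      exact hX
    have hseg : ∀ a : μ.ord.ToType, #(Set.Iic a) ≤ cardSucc κ j := fun a => by
      have h₁ : #(Set.Iio a) ≤ cardSucc κ j := by
        rw [← Order.lt_succ_iff, ← cardSucc_succ, ← hμ]
        convert! Cardinal.mk_Iio_lt a (by simp)
        simp
      rw [← Set.Iio_insert]
      refine Cardinal.mk_insert_le.trans (Cardinal.add_le_of_le (hκ.trans (le_cardSucc κ j)) h₁ ?_)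
      exact Cardinal.one_le_aleph0.trans (hκ.trans (le_cardSucc κ j))
    choose F hF using fun a => ih (hseg a)
    have hmax : ∀ x : Fin (j + 2) → X, ∃ i, ∀ m, f (x m) ≤ f (x i) := fun x =>
      Finite.exists_max fun i => f (x i)
    choose M hM using hmax
    obtain ⟨e⟩ : Nonempty (Fin (j + 2) × Fin (j + 1) × κ.out ↪ κ.out) := by
      rw [← Cardinal.le_def]
      simp only [Cardinal.mk_prod, Cardinal.lift_id, Cardinal.mk_out]
      exact Cardinal.mul_le_of_le hκ (Cardinal.mk_le_aleph0.trans hκ)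
        (Cardinal.mul_le_of_le hκ (Cardinal.mk_le_aleph0.trans hκ) le_rfl)
    let R : (x : Fin (j + 2) → X) → Fin (j + 1) → Set.Iic (f (x (M x))) := fun x i =>
      ⟨f (x ((M x).succAbove i)), hM x _⟩
    refine ⟨fun x => ((M x).succAbove (F _ (R x)).1, e (M x, F _ (R x))), fun x y h hxy => ?_⟩
    obtain ⟨hMxy, hFxy⟩ := Prod.mk.inj (e.injective (Prod.mk.inj h).2)
    have hxM : x (M x) = y (M y) := by
      rw [← hMxy]
      exact hxy _ (Fin.succAbove_ne _ _).symm
    have gen : ∀ a b (hab : a = b) (u : Fin (j + 1) → Set.Iic a) (v : Fin (j + 1) → Set.Iic b),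
        F a u = F b v → (∀ i, i ≠ (F a u).1 → (u i : μ.ord.ToType) = v i) →
          ∀ i, (u i : μ.ord.ToType) = v i := by
      rintro a _ rfl u v huv h i
      rw [hF a u v huv fun i hi => Subtype.ext (h i hi)]
    have key := gen _ _ (congrArg f hxM) (R x) (R y) hFxy fun i hi => by
      simp only [R]
      rw [← hMxy, hxy _ fun h => hi (Fin.succAbove_right_injective h)]
    funext i
    rcases Fin.eq_self_or_eq_succAbove (M x) i with rfl | ⟨m, rfl⟩
    · exact hxM.trans (by rw [hMxy])
    · refine f.injective ((key m).trans ?_)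
      simp only [R]
      rw [hMxy]

end Combinatorics

section ChromaticNumber

theorem chrNum_eq {V : Type} {E : Set (Set V)} {κ : Cardinal} (h : HGColorable E κ)
    (hmin : ∀ μ, HGColorable E μ → κ ≤ μ) : chrNum E = κ :=
  le_antisymm (csInf_le' h) (le_csInf ⟨κ, h⟩ hmin)

theorem hgColorable_zeroEdges_continuum {n k : ℕ} (hk : 2 ≤ k)
    (p : MvPolynomial (Fin k × Fin n) ℝ) : HGColorable (zeroEdges p) Cardinal.continuum := by
  refine ⟨Fin n → ℝ, id, ?_, ?_⟩
  · rw [← Cardinal.power_def, Cardinal.mk_real]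
    exact Cardinal.pow_le Cardinal.aleph0_le_continuum Cardinal.mk_lt_aleph0
  · rintro _ ⟨a, ha, rfl, -⟩
    refine ⟨_, ⟨⟨0, by omega⟩, rfl⟩, _, ⟨⟨1, by omega⟩, rfl⟩, fun h => ?_⟩
    simpa using ha h

theorem hgColorable_chrNum_zeroEdges {n k : ℕ} (hk : 2 ≤ k)
    (p : MvPolynomial (Fin k × Fin n) ℝ) : HGColorable (zeroEdges p) (chrNum (zeroEdges p)) :=
  csInf_mem (s := {κ | HGColorable (zeroEdges p) κ}) ⟨_, hgColorable_zeroEdges_continuum hk p⟩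

theorem one_le_of_hgColorable {V : Type} [Nonempty V] {E : Set (Set V)} {κ : Cardinal}
    (h : HGColorable E κ) : 1 ≤ κ := by
  obtain ⟨α, φ, hα, -⟩ := h
  have : Nonempty α := ‹Nonempty V›.map φ
  exact (Cardinal.one_le_iff_ne_zero.2 (Cardinal.mk_ne_zero α)).trans hα

theorem exists_chrNum_eq_of_continuum_eq_cardSucc {k j : ℕ} (hj : j + 2 ≤ k) {κ : Cardinal}
    (hκ : ℵ₀ < κ) (hc : Cardinal.continuum = cardSucc κ j) :
    ∃ p : MvPolynomial (Fin k × Fin (j + 1)) ℝ, chrNum (zeroEdges p) = κ := by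
  let z : Fin k := ⟨0, by omega⟩
  let dir : Fin k → Fin (j + 1) := fun m => ⟨min (m - 1) j, by omega⟩
  let p : MvPolynomial (Fin k × Fin (j + 1)) ℝ := ∑ m, ∑ i,
    if i = dir m then 0 else (MvPolynomial.X (m, i) - MvPolynomial.X (z, i)) ^ 2
  have hp : ∀ a : Fin k → Fin (j + 1) → ℝ, MvPolynomial.eval (fun q => a q.1 q.2) p = 0 ↔
      ∀ m i, i ≠ dir m → a m i = a z i := fun a => by
    simp only [p, map_sum, apply_ite (MvPolynomial.eval _), map_pow, map_sub,
      MvPolynomial.eval_X, map_zero]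
    rw [Finset.sum_eq_zero_iff_of_nonneg fun m _ =>
      Finset.sum_nonneg fun i _ => by split_ifs <;> positivity]
    simp only [Finset.mem_univ, true_imp_iff]
    refine forall_congr' fun m => ?_
    rw [Finset.sum_eq_zero_iff_of_nonneg fun i _ => by split_ifs <;> positivity]
    simp [sub_eq_zero]
  refine ⟨p, chrNum_eq ?_ fun μ hμ => ?_⟩
  · obtain ⟨F, hF⟩ := exists_coloring_with_directions hκ.le j
      (X := ℝ) (by rw [Cardinal.mk_real, hc])
    refine ⟨Fin (j + 1) × κ.out, F, ?_, ?_⟩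
    · simp only [Cardinal.mk_prod, Cardinal.lift_id, Cardinal.mk_out]
      exact Cardinal.mul_le_of_le hκ.le (Cardinal.mk_le_aleph0.trans hκ.le) le_rfl
    · rintro _ ⟨a, ha, rfl, h⟩
      rw [hp] at h
      let m : Fin k := ⟨(F (a z)).1 + 1, by omega⟩
      refine ⟨_, ⟨z, rfl⟩, _, ⟨m, rfl⟩, fun hzm => ?_⟩
      have hdir : dir m = (F (a z)).1 := by
        ext
        simp only [dir, m]
        omega
      have := ha (hF _ _ hzm fun i hi => (h m i (hdir ▸ hi)).symm)
      simp [z, m] at this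
  · obtain ⟨α, φ, hα, hφ⟩ := hμ
    by_contra! hlt
    have hX : cardSucc (max μ ℵ₀) (j + 1) ≤ #ℝ := by
      rw [Cardinal.mk_real, hc, cardSucc_succ']
      exact cardSucc_mono_left (Order.succ_le_of_lt (max_lt hlt hκ)) j
    obtain ⟨g, r, hg, hr⟩ := exists_monochromatic_grid (le_max_right μ ℵ₀)
      (hα.trans (le_max_left _ _)) (L := Fin k) (j + 1) hX φ
    let u : Fin k → Fin (j + 1) → Fin k := fun m i => if i = dir m then m else z
    have hinj : Function.Injective fun m i => g i (u m i) := fun m m' h => by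
      have h₁ : ∀ i, u m i = u m' i := fun i => hg i (congrFun h i)
      have h₂ := h₁ (dir m)
      have h₃ := h₁ (dir m')
      simp only [u] at h₂ h₃
      grind
    have hzero : MvPolynomial.eval (fun q : Fin k × Fin (j + 1) => g q.2 (u q.1 q.2)) p = 0 :=
      (hp fun m i => g i (u m i)).2 fun m i hi => by simp [u, hi]
    obtain ⟨x, ⟨m, rfl⟩, y, ⟨m', rfl⟩, hne⟩ := hφ _ ⟨_, hinj, rfl, hzero⟩
    exact hne (by simp only [hr])

theorem exists_chrNum_eq_natCast {k : ℕ} (hk : 2 ≤ k) (m : ℕ) :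
    ∃ p : MvPolynomial (Fin k × Fin 1) ℝ, chrNum (zeroEdges p) = (m + 1 : ℕ) := by
  let N := (k - 1) * m + 1
  let p : MvPolynomial (Fin k × Fin 1) ℝ := ∑ j : Fin k,
    (∏ i ∈ Finset.range N, (MvPolynomial.X (j, 0) - MvPolynomial.C (i : ℝ))) ^ 2
  have hp : ∀ a : Fin k → Fin 1 → ℝ, MvPolynomial.eval (fun q => a q.1 q.2) p = 0 ↔
      ∀ j, ∃ i < N, a j 0 = i := fun a => by
    simp only [p, map_sum, map_pow, map_prod, map_sub, MvPolynomial.eval_X, MvPolynomial.eval_C]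
    rw [Finset.sum_eq_zero_iff_of_nonneg fun m _ => by positivity]
    simp [Finset.prod_eq_zero_iff, sub_eq_zero]
  refine ⟨p, chrNum_eq ?_ fun μ hμ => ?_⟩
  · refine ⟨Fin (m + 1), fun x => Fin.ofNat (m + 1) (⌊x 0⌋₊ / (k - 1)), by simp, ?_⟩
    rintro _ ⟨a, ha, rfl, h⟩
    rw [hp] at h
    choose i hi hai using h
    by_contra! hcon
    have hinj : Function.Injective i := fun j j' hjj => ha (by
      funext l
      rw [Subsingleton.elim l 0, hai, hai, hjj])
    set b := i ⟨0, by omega⟩ / (k - 1) with hb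
    have hlt : ∀ j, i j / (k - 1) < m + 1 := fun j => by
      rw [Nat.div_lt_iff_lt_mul (by omega)]
      have := hi j
      simp only [N] at this
      nlinarith [Nat.sub_add_cancel (show 1 ≤ k by omega)]
    have hdiv : ∀ j, i j / (k - 1) = b := fun j => by
      have := hcon _ ⟨j, rfl⟩ _ ⟨⟨0, by omega⟩, rfl⟩
      simp only [hai, Nat.floor_natCast, Fin.ofNat, Fin.mk.injEq] at this
      rwa [Nat.mod_eq_of_lt (hlt _), Nat.mod_eq_of_lt (hlt _)] at this
    have hmaps : ∀ j, i j ∈ Finset.Ico (b * (k - 1)) (b * (k - 1) + (k - 1)) := fun j => by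
      rw [Finset.mem_Ico, ← hdiv j]
      exact ⟨Nat.div_mul_le_self _ _, Nat.lt_div_mul_add (by omega)⟩
    have := Finset.card_le_card_of_injOn i (s := Finset.univ) (fun j _ => hmaps j)
      hinj.injOn
    simp at this
    omega
  · obtain ⟨α, φ, hα, hφ⟩ := hμ
    by_contra! hlt
    have hαfin : Finite α := Cardinal.lt_aleph0_iff_finite.1
      ((hα.trans_lt hlt).trans (Cardinal.natCast_lt_aleph0))
    have := Fintype.ofFinite α
    classical
    have hcardα : Fintype.card α ≤ m := by
      have := hα.trans_lt hlt
      rw [Cardinal.mk_fintype] at this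
      exact Nat.lt_succ_iff.1 (by exact_mod_cast this)
    obtain ⟨r, -, hr⟩ := Finset.exists_lt_card_fiber_of_mul_lt_card_of_maps_to
      (s := Finset.range N) (t := (Finset.univ : Finset α)) (f := fun i => φ fun _ => (i : ℝ))
      (n := k - 1) (fun _ _ => Finset.mem_univ _) (by
        rw [Finset.card_univ, Finset.card_range]
        simp only [N]
        nlinarith)
    obtain ⟨S, hS, hScard⟩ := Finset.exists_subset_card_eq (Nat.le_of_pred_lt hr)
    let e := S.orderEmbOfFin hScard
    have he : ∀ j, e j ∈ S := fun j => Finset.orderEmbOfFin_mem S hScard j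
    have hinj : Function.Injective fun (j : Fin k) (_ : Fin 1) => (e j : ℝ) := fun j j' h =>
      e.injective (Nat.cast_injective (congrFun h 0))
    have hzero : MvPolynomial.eval (fun q : Fin k × Fin 1 => (e q.1 : ℝ)) p = 0 :=
      (hp fun j _ => e j).2 fun j =>
        ⟨e j, Finset.mem_range.1 (Finset.mem_filter.1 (hS (he j))).1, rfl⟩
    obtain ⟨x, ⟨j, rfl⟩, y, ⟨j', rfl⟩, hne⟩ := hφ _ ⟨_, hinj, rfl, hzero⟩
    exact hne ((Finset.mem_filter.1 (hS (he j))).2.trans (Finset.mem_filter.1 (hS (he j'))).2.symm)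

theorem exists_chrNum_eq_aleph0 {k : ℕ} (hk : 2 ≤ k) :
    ∃ p : MvPolynomial (Fin k × Fin 3) ℝ, chrNum (zeroEdges p) = ℵ₀ := by
  let z : Fin k := ⟨0, by omega⟩
  let p : MvPolynomial (Fin k × Fin 3) ℝ := ∑ m : Fin k, if m = z then 0 else
    (MvPolynomial.X (m, 0) - (MvPolynomial.X (z, 0) + 1 + MvPolynomial.X (z, 1) ^ 2)) ^ 2
  have hp : ∀ a : Fin k → Fin 3 → ℝ, MvPolynomial.eval (fun q => a q.1 q.2) p = 0 ↔
      ∀ m, m ≠ z → a m 0 = a z 0 + 1 + a z 1 ^ 2 := fun a => by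
    simp only [p, map_sum, apply_ite (MvPolynomial.eval _), map_pow, map_sub, map_add, map_one,
      MvPolynomial.eval_X, map_zero]
    rw [Finset.sum_eq_zero_iff_of_nonneg fun m _ => by positivity]
    simp [sub_eq_zero]
  refine ⟨p, chrNum_eq ?_ fun μ hμ => ?_⟩
  · refine ⟨ℤ, fun x => ⌊x 0⌋, Cardinal.mk_le_aleph0, ?_⟩
    rintro _ ⟨a, ha, rfl, h⟩
    rw [hp] at h
    refine ⟨_, ⟨z, rfl⟩, _, ⟨⟨1, by omega⟩, rfl⟩, fun h₁ => ?_⟩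
    have h₂ := h ⟨1, by omega⟩ (by simp [z])
    have h₃ := Int.floor_le (a z 0)
    have h₄ := Int.lt_floor_add_one (a ⟨1, by omega⟩ 0)
    rw [← show ⌊a z 0⌋ = ⌊a ⟨1, by omega⟩ 0⌋ from h₁] at h₄
    nlinarith [sq_nonneg (a z 1)]
  · obtain ⟨α, φ, hα, hφ⟩ := hμ
    by_contra! hlt
    have hαfin : Finite α := Cardinal.lt_aleph0_iff_finite.1 (hα.trans_lt hlt)
    have hc : ∀ x u : ℝ, ∃ r, Infinite ((fun t : ℝ => φ ![x, u, t]) ⁻¹' {r}) := fun x u =>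
      Finite.exists_infinite_fiber _
    choose c hc using hc
    obtain ⟨i, j, hij, hCij⟩ := Finite.exists_ne_map_eq_of_infinite
      fun i : ℕ => Set.range (c (i : ℝ))
    wlog hlt' : i < j generalizing i j
    · exact this j i hij.symm hCij.symm (by omega)
    have hu : √((j : ℝ) - i - 1) ^ 2 = j - i - 1 := Real.sq_sqrt (by
      have : (i : ℝ) + 1 ≤ j := by exact_mod_cast hlt'
      linarith)
    set u := √((j : ℝ) - i - 1)
    obtain ⟨u', hu'⟩ : c i u ∈ Set.range (c (j : ℝ)) := hCij ▸ ⟨u, rfl⟩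
    have h₁ := hc i u
    have h₂ := hc j u'
    obtain ⟨t₀, ht₀⟩ := h₁.nonempty
    let t := Infinite.natEmbedding ((fun t : ℝ => φ ![(j : ℝ), u', t]) ⁻¹' {c j u'})
    let a : Fin k → Fin 3 → ℝ := fun m => if m = z then ![(i : ℝ), u, t₀] else
      ![(j : ℝ), u', t m]
    have haφ : ∀ m, φ (a m) = c i u := fun m => by
      by_cases hm : m = z
      · simpa [a, hm] using ht₀
      · simpa [a, hm, hu'] using (t m).2
    have hija : (i : ℝ) ≠ j := by exact_mod_cast hij
    obtain ⟨x, ⟨m, rfl⟩, y, ⟨m', rfl⟩, hne⟩ := hφ _ ⟨a, fun m m' h => by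
      have h0 := congrFun h 0
      have h2 := congrFun h 2
      by_cases hm : m = z <;> by_cases hm' : m' = z
      · rw [hm, hm']
      · simp [a, hm, hm', hija] at h0
      · simp [a, hm, hm', hija.symm] at h0
      · simp only [a, hm, hm', if_false] at h2
        exact Fin.val_injective (t.injective (Subtype.ext h2)), rfl, (hp _).2 fun m hm => by
          simp only [a, hm, if_true, if_false]
          simp [hu]⟩
    exact hne (by rw [haφ, haφ])

end ChromaticNumber

section AlgebraicFunctions

open Polynomial Filter Topology
open scoped ContDiff

/-- The value `q(s, y)` of a polynomial in `y` whose coefficients are polynomials in `s`. -/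
noncomputable def evalAt {F : Subfield ℝ} {σ : Type} (q : (MvPolynomial σ F)[X]) (s : σ → ℝ)
    (y : ℝ) : ℝ :=
  q.eval₂ (MvPolynomial.aeval s : MvPolynomial σ F →ₐ[F] ℝ).toRingHom y

theorem evalAt_map_aeval {F : Subfield ℝ} {σ τ : Type} (q : (MvPolynomial σ F)[X])
    (h : σ → MvPolynomial τ F) (s : τ → ℝ) (y : ℝ) :
    evalAt (q.map (MvPolynomial.aeval h : MvPolynomial σ F →ₐ[F] MvPolynomial τ F).toRingHom) s y =
      evalAt q (fun i => MvPolynomial.aeval s (h i)) y := by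
  rw [evalAt, evalAt, eval₂_map]
  congr 1
  ext
  · simp
  · simp

theorem contDiff_aeval {F : Subfield ℝ} {σ : Type} [Fintype σ] (c : MvPolynomial σ F) :
    ContDiff ℝ ω fun s : σ → ℝ => MvPolynomial.aeval s c := by
  induction c using MvPolynomial.induction_on with
  | C r => simpa using contDiff_const
  | add p q hp hq => simpa using hp.add hq
  | mul_X p i hp => simpa using hp.mul (contDiff_apply ℝ ℝ i)

theorem contDiff_evalAt {F : Subfield ℝ} {σ : Type} [Fintype σ] (q : (MvPolynomial σ F)[X]) :
    ContDiff ℝ ω fun v : (σ → ℝ) × ℝ => evalAt q v.1 v.2 := by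
  induction q using Polynomial.induction_on' with
  | add p q hp hq => simpa [evalAt, eval₂_add] using hp.add hq
  | monomial m c =>
    simpa [evalAt, eval₂_monomial] using
      ((contDiff_aeval c).comp contDiff_fst).mul (contDiff_snd.pow m)

theorem hasDerivAt_evalAt {F : Subfield ℝ} {σ : Type} (q : (MvPolynomial σ F)[X]) (s : σ → ℝ)
    (y : ℝ) : HasDerivAt (evalAt q s) (evalAt (derivative q) s y) y := by
  unfold evalAt
  simp only [← eval_map, ← derivative_map]
  exact Polynomial.hasDerivAt _ y

theorem exists_implicit_function {F : Subfield ℝ} {σ : Type} [Fintype σ]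
    {q : (MvPolynomial σ F)[X]} {t : σ → ℝ} {a : ℝ} (h : evalAt q t a = 0)
    (h' : evalAt (derivative q) t a ≠ 0) :
    ∃ φ : (σ → ℝ) → ℝ, AnalyticAt ℝ φ t ∧ φ t = a ∧
      ∀ᶠ v in 𝓝 (t, a), evalAt q v.1 v.2 = 0 ↔ φ v.1 = v.2 := by
  set f : (σ → ℝ) × ℝ → ℝ := fun v => evalAt q v.1 v.2
  have hf : ContDiffAt ℝ ω f (t, a) := (contDiff_evalAt q).contDiffAt
  have hn : (ω : WithTop ℕ∞) ≠ 0 := by simp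
  have hinv : (fderiv ℝ f (t, a) ∘L .inr ℝ (σ → ℝ) ℝ).IsInvertible := by
    have h₁ : HasFDerivAt (fun y => f (t, y)) (fderiv ℝ f (t, a) ∘L .inr ℝ (σ → ℝ) ℝ) a :=
      (hf.differentiableAt hn).hasFDerivAt.comp a (hasFDerivAt_prodMk_right t a)
    refine ⟨ContinuousLinearEquiv.unitsEquivAut ℝ (Units.mk0 _ h'), ?_⟩
    ext
    have h₂ := h₁.hasDerivAt.unique (hasDerivAt_evalAt q t a)
    simpa using h₂.symm
  refine ⟨hf.implicitFunction hn hinv, (hf.contDiffAt_implicitFunction hn hinv).analyticAt,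
    hf.implicitFunction_apply_self hn hinv, ?_⟩
  have := hf.eventually_apply_eq_iff_implicitFunction hn hinv
  simpa only [f, h] using this

/-- On `B`, the equation `q(s, y) = 0` has a unique solution `y` in the interval `J`, and this
solution is simple. -/
def IsBranch {F : Subfield ℝ} {σ : Type} (q : (MvPolynomial σ F)[X]) (J : ℚ × ℚ)
    (B : Set (σ → ℝ)) : Prop :=
  ∀ s ∈ B, ∃ y ∈ Set.Ioo (J.1 : ℝ) J.2, evalAt q s y = 0 ∧ evalAt (derivative q) s y ≠ 0 ∧
    ∀ y' ∈ Set.Ioo (J.1 : ℝ) J.2, evalAt q s y' = 0 → y' = y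

open Classical in
/-- A solution `y` of `q(s, y) = 0` in the interval `J`, as a function of `s`. -/
noncomputable def branch {F : Subfield ℝ} {σ : Type} (q : (MvPolynomial σ F)[X]) (J : ℚ × ℚ)
    (s : σ → ℝ) : ℝ :=
  if h : ∃ y ∈ Set.Ioo (J.1 : ℝ) J.2, evalAt q s y = 0 then h.choose else 0

namespace IsBranch

variable {F : Subfield ℝ} {σ : Type} {q : (MvPolynomial σ F)[X]} {J : ℚ × ℚ} {B : Set (σ → ℝ)}
  {s : σ → ℝ}

theorem mono (h : IsBranch q J B) {B' : Set (σ → ℝ)} (hB : B' ⊆ B) : IsBranch q J B' :=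
  fun s hs => h s (hB hs)

theorem branch_spec (h : IsBranch q J B) (hs : s ∈ B) :
    branch q J s ∈ Set.Ioo (J.1 : ℝ) J.2 ∧ evalAt q s (branch q J s) = 0 := by
  have hex : ∃ y ∈ Set.Ioo (J.1 : ℝ) J.2, evalAt q s y = 0 := by
    obtain ⟨y, hy, h0, -⟩ := h s hs
    exact ⟨y, hy, h0⟩
  rw [branch, dif_pos hex]
  exact hex.choose_spec

theorem eq_branch (h : IsBranch q J B) (hs : s ∈ B) {y : ℝ}
    (hy : y ∈ Set.Ioo (J.1 : ℝ) J.2) (h0 : evalAt q s y = 0) : y = branch q J s := by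
  obtain ⟨y', -, -, -, huniq⟩ := h s hs
  obtain ⟨h₁, h₂⟩ := h.branch_spec hs
  rw [huniq _ hy h0, huniq _ h₁ h₂]

theorem derivative_ne_zero (h : IsBranch q J B) (hs : s ∈ B) :
    evalAt (derivative q) s (branch q J s) ≠ 0 := by
  obtain ⟨y, hy, h0, h', -⟩ := h s hs
  rwa [← h.eq_branch hs hy h0]

theorem exists_evalAt_ne_zero (h : IsBranch q J B) (hs : s ∈ B) : ∃ y, evalAt q s y ≠ 0 := by
  by_contra! h0
  have h₁ := hasDerivAt_evalAt q s (branch q J s)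
  rw [show evalAt q s = fun _ => 0 from funext h0] at h₁
  exact h.derivative_ne_zero hs (h₁.unique (hasDerivAt_const _ _))

theorem analyticAt_branch [Fintype σ] (h : IsBranch q J B) (hB : IsOpen B) (hs : s ∈ B) :
    AnalyticAt ℝ (branch q J) s := by
  obtain ⟨φ, hφ, hφs, hev⟩ := exists_implicit_function (h.branch_spec hs).2
    (h.derivative_ne_zero hs)
  refine hφ.congr ?_
  have hcont : Tendsto (fun u => (u, φ u)) (𝓝 s) (𝓝 (s, branch q J s)) := by
    conv_rhs => rw [← hφs]
    exact continuousAt_id.prodMk hφ.continuousAt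
  have hJ : ∀ᶠ u in 𝓝 s, φ u ∈ Set.Ioo (J.1 : ℝ) J.2 :=
    hφ.continuousAt.eventually (hφs ▸ Ioo_mem_nhds (h.branch_spec hs).1.1 (h.branch_spec hs).1.2)
  filter_upwards [hcont.eventually hev, hJ, hB.mem_nhds hs] with u hu hJu hBu
  exact h.eq_branch hBu hJu (hu.2 rfl)

end IsBranch

theorem exists_isBranch {F : Subfield ℝ} {σ : Type} [Fintype σ]
    {q : (MvPolynomial σ F)[X]} {t : σ → ℝ} {a : ℝ} (h : evalAt q t a = 0)
    (h' : evalAt (derivative q) t a ≠ 0) :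
    ∃ J : ℚ × ℚ, a ∈ Set.Ioo (J.1 : ℝ) J.2 ∧ ∃ U ∈ 𝓝 t, IsBranch q J U := by
  obtain ⟨φ, hφ, hφt, hev⟩ := exists_implicit_function h h'
  have hd : ∀ᶠ v in 𝓝 (t, a), evalAt (derivative q) v.1 v.2 ≠ 0 :=
    (contDiff_evalAt (derivative q)).continuous.continuousAt.eventually_ne h'
  obtain ⟨U, hU, W, hW, hUW⟩ := mem_nhds_prod_iff.1 (hev.and hd)
  obtain ⟨l, u, hlu, hW'⟩ := mem_nhds_iff_exists_Ioo_subset.1 hW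
  obtain ⟨l', hl, hl'⟩ := exists_rat_btwn hlu.1
  obtain ⟨u', hu, hu'⟩ := exists_rat_btwn hlu.2
  have hJW : Set.Ioo (l' : ℝ) u' ⊆ W := (Set.Ioo_subset_Ioo hl.le hu'.le).trans hW'
  have hJ : ∀ᶠ s in 𝓝 t, φ s ∈ Set.Ioo (l' : ℝ) u' :=
    hφ.continuousAt.eventually (hφt ▸ Ioo_mem_nhds hl' hu)
  refine ⟨(l', u'), ⟨hl', hu⟩, _, inter_mem hU hJ, fun s hs => ⟨φ s, hs.2, ?_⟩⟩
  have h₁ : ∀ y ∈ Set.Ioo (l' : ℝ) u', (evalAt q s y = 0 ↔ φ s = y) ∧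
      evalAt (derivative q) s y ≠ 0 := fun y hy => hUW (Set.mk_mem_prod hs.1 (hJW hy))
  exact ⟨(h₁ _ hs.2).1.2 rfl, (h₁ _ hs.2).2, fun y hy h0 => ((h₁ y hy).1.1 h0).symm⟩

/-- `a` is algebraic over the field generated by `F` and the numbers `t i`. -/
def AlgOver (F : Subfield ℝ) {σ : Type} (t : σ → ℝ) (a : ℝ) : Prop :=
  ∃ q : (MvPolynomial σ F)[X], (∃ y, evalAt q t y ≠ 0) ∧ evalAt q t a = 0

theorem AlgOver.exists_simple_root {F : Subfield ℝ} {σ : Type} {t : σ → ℝ} {a : ℝ}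
    (h : AlgOver F t a) :
    ∃ q : (MvPolynomial σ F)[X], evalAt q t a = 0 ∧ evalAt (derivative q) t a ≠ 0 := by
  classical
  have hex : ∃ m, ∃ q : (MvPolynomial σ F)[X], q.natDegree = m ∧ (∃ y, evalAt q t y ≠ 0) ∧
      evalAt q t a = 0 := by
    obtain ⟨q, hq⟩ := h
    exact ⟨_, q, rfl, hq⟩
  obtain ⟨q, hqm, ⟨y, hy⟩, hqa⟩ := Nat.find_spec hex
  refine ⟨q, hqa, fun hder => hy ?_⟩
  by_cases hdeg : q.natDegree = 0
  · rw [eq_C_of_natDegree_eq_zero hdeg] at hqa ⊢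
    simpa [evalAt] using hqa
  · have h₁ := Nat.find_min hex (hqm ▸ natDegree_derivative_lt hdeg)
    have h₂ : ∀ y, evalAt (derivative q) t y = 0 := fun y => by
      by_contra hne
      exact h₁ ⟨_, rfl, ⟨y, hne⟩, hder⟩
    rw [← hqa]
    exact is_const_of_deriv_eq_zero (fun y => (hasDerivAt_evalAt q t y).differentiableAt)
      (fun y => (hasDerivAt_evalAt q t y).deriv.trans (h₂ y)) y a


/-- On `U`, the function `g` is algebraic over the ring of polynomials with coefficients in `F`. -/
def AlgebraicOn (F : Subfield ℝ) {V : Type} (U : Set (V → ℝ)) (g : (V → ℝ) → ℝ) : Prop :=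
  ∃ Q : (MvPolynomial V F)[X], Q ≠ 0 ∧ ∀ s ∈ U, evalAt Q s (g s) = 0

theorem AlgebraicOn.aeval {F : Subfield ℝ} {V ι : Type} {U : Set (V → ℝ)}
    {g : ι → (V → ℝ) → ℝ} (hg : ∀ i, AlgebraicOn F U (g i)) (p : MvPolynomial ι F) :
    AlgebraicOn F U fun s => MvPolynomial.aeval (fun i => g i s) p := by
  let ρ : MvPolynomial V F →+* (U → ℝ) := RingHom.pi fun s =>
    (MvPolynomial.aeval s.1 : MvPolynomial V F →ₐ[F] ℝ).toRingHom
  let _ : Algebra (MvPolynomial V F) (U → ℝ) := ρ.toAlgebra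
  have key : ∀ f : (V → ℝ) → ℝ,
      AlgebraicOn F U f ↔ IsAlgebraic (MvPolynomial V F) fun s : U => f s.1 := fun f => by
    refine exists_congr fun Q => and_congr_right fun _ => ?_
    have h : ∀ s : U, Polynomial.aeval (fun s : U => f s.1) Q s = evalAt Q s.1 (f s.1) :=
      fun s => by
        rw [Polynomial.aeval_def, evalAt]
        exact hom_eval₂ Q (algebraMap (MvPolynomial V F) (U → ℝ)) (Pi.evalRingHom _ s) _
    rw [funext_iff]
    simp only [h, Pi.zero_apply, Subtype.forall]
  simp only [key] at hg ⊢
  induction p using MvPolynomial.induction_on with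
  | C r =>
    convert isAlgebraic_algebraMap (A := U → ℝ) (MvPolynomial.C r : MvPolynomial V F) using 1
    ext s
    change _ = MvPolynomial.aeval s.1 (MvPolynomial.C r)
    simp
  | add p q hp hq =>
    simp only [map_add]
    exact hp.add hq
  | mul_X p i hp =>
    simp only [map_mul, MvPolynomial.aeval_X]
    exact hp.mul (hg i)

theorem exists_eq_X_pow_mul {R : Type} [CommRing R] [IsDomain R] {Q : R[X]} (hQ : Q ≠ 0) :
    ∃ (m : ℕ) (Q₁ : R[X]), Q = X ^ m * Q₁ ∧ Q₁.coeff 0 ≠ 0 := by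
  obtain ⟨Q₁, hQ₁, hdvd⟩ := exists_eq_pow_rootMultiplicity_mul_and_not_dvd Q hQ 0
  rw [C_0, sub_zero] at hQ₁ hdvd
  exact ⟨_, Q₁, hQ₁, X_dvd_iff.not.1 hdvd⟩

/-- An algebraic analytic function that vanishes at a generic point vanishes identically. -/
theorem AlgebraicOn.eqOn_zero {F : Subfield ℝ} {V : Type} [Fintype V] {U : Set (V → ℝ)}
    (hU : IsOpen U) (hU' : IsPreconnected U) {g : (V → ℝ) → ℝ} (hg : AlgebraicOn F U g)
    (hga : AnalyticOnNhd ℝ g U) {v : V → ℝ} (hv : AlgebraicIndependent F v) (hvU : v ∈ U)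
    (h : g v = 0) : Set.EqOn g 0 U := by
  obtain ⟨Q, hQ, hQg⟩ := hg
  obtain ⟨m, Q₁, rfl, hQ₁⟩ := exists_eq_X_pow_mul hQ
  have hne : evalAt Q₁ v (g v) ≠ 0 := by
    rw [h, evalAt, eval₂_at_zero]
    exact fun h0 => hQ₁ (hv.eq_zero_of_aeval_eq_zero _ h0)
  have hcont : Tendsto (fun s => (s, g s)) (𝓝 v) (𝓝 (v, g v)) :=
    continuousAt_id.prodMk (hga v hvU).continuousAt
  have hev : ∀ᶠ w in 𝓝 (v, g v), evalAt Q₁ w.1 w.2 ≠ 0 :=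
    (contDiff_evalAt Q₁).continuous.continuousAt.eventually_ne hne
  refine hga.eqOn_zero_of_preconnected_of_eventuallyEq_zero hU' hvU ?_
  filter_upwards [hcont.eventually hev, hU.mem_nhds hvU] with s hs hsU
  have h₁ := hQg s hsU
  rw [evalAt, eval₂_mul, eval₂_pow, eval₂_X] at h₁
  exact eq_zero_of_pow_eq_zero ((mul_eq_zero.1 h₁).resolve_right hs)

/-- The open box with rational endpoints `I i`. -/
def ratBox {σ : Type} (I : σ → ℚ × ℚ) : Set (σ → ℝ) :=
  {s | ∀ i, s i ∈ Set.Ioo ((I i).1 : ℝ) (I i).2}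

theorem isOpen_ratBox {σ : Type} [Finite σ] (I : σ → ℚ × ℚ) : IsOpen (ratBox I) := by
  simp only [ratBox, Set.ofPred_forall]
  exact isOpen_iInter_of_finite fun i => isOpen_Ioo.preimage (continuous_apply i)

theorem convex_ratBox {σ : Type} (I : σ → ℚ × ℚ) : Convex ℝ (ratBox I) := by
  simp only [ratBox, Set.ofPred_forall]
  exact convex_iInter fun i => (convex_Ioo _ _).linear_preimage (LinearMap.proj i)

theorem analyticAt_branch_comp {F : Subfield ℝ} {σ V : Type} [Fintype σ] [Fintype V]
    {I : σ → ℚ × ℚ} {q : (MvPolynomial σ F)[X]} {J : ℚ × ℚ} (hq : IsBranch q J (ratBox I))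
    (w : σ → V) {u : V → ℝ} (hu : u ∘ w ∈ ratBox I) :
    AnalyticAt ℝ (fun u : V → ℝ => branch q J (u ∘ w)) u :=
  AnalyticAt.fun_comp (f := fun u : V → ℝ => u ∘ w)
    (hq.analyticAt_branch (isOpen_ratBox I) hu)
    ((LinearMap.toContinuousLinearMap (LinearMap.funLeft ℝ ℝ w)).analyticAt u)

theorem algebraicOn_branch_comp {F : Subfield ℝ} {σ V : Type} 
    {I : σ → ℚ × ℚ} {q : (MvPolynomial σ F)[X]} {J : ℚ × ℚ} (hq : IsBranch q J (ratBox I))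
    (w : σ → V) {U : Set (V → ℝ)} (hU : ∀ u ∈ U, u ∘ w ∈ ratBox I) (hne : U.Nonempty) :
    AlgebraicOn F U fun u : V → ℝ => branch q J (u ∘ w) := by
  have key : ∀ u y, evalAt (q.map (MvPolynomial.aeval fun i => MvPolynomial.X (w i) :
      MvPolynomial σ F →ₐ[F] MvPolynomial V F).toRingHom) u y = evalAt q (u ∘ w) y := fun u y => by
    rw [evalAt_map_aeval]
    simp [Function.comp_def]
  refine ⟨_, fun h0 => ?_, fun u hu => (key _ _).trans (hq.branch_spec (hU u hu)).2⟩
  obtain ⟨u, hu⟩ := hne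
  obtain ⟨y, hy⟩ := hq.exists_evalAt_ne_zero (hU u hu)
  rw [← key, h0] at hy
  simp [evalAt] at hy

theorem aeval_branch_eq_zero_of_finite {F : Subfield ℝ} {σ ι K V : Type} [Finite σ] [Finite K]
    [Finite V] {I : σ → ℚ × ℚ} {q : ι → (MvPolynomial σ F)[X]} {J : ι → ℚ × ℚ}
    (hq : ∀ l, IsBranch (q l) (J l) (ratBox I)) (p : MvPolynomial (K × ι) F) (w : K → σ → V)
    {v : V → ℝ} (hv : AlgebraicIndependent F v) (hvw : ∀ j, v ∘ w j ∈ ratBox I)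
    (h : MvPolynomial.aeval (fun x : K × ι => branch (q x.2) (J x.2) (v ∘ w x.1)) p = 0)
    {s : V → ℝ} (hs : ∀ j, s ∘ w j ∈ ratBox I) :
    MvPolynomial.aeval (fun x : K × ι => branch (q x.2) (J x.2) (s ∘ w x.1)) p = 0 := by
  cases nonempty_fintype V
  cases nonempty_fintype σ
  set U : Set (V → ℝ) := ⋂ j, (fun s => s ∘ w j) ⁻¹' ratBox I
  have hU : IsOpen U := isOpen_iInter_of_finite fun j => (isOpen_ratBox I).preimage (by fun_prop)
  have hU' : Convex ℝ U := convex_iInter fun j =>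
    (convex_ratBox I).linear_preimage (LinearMap.funLeft ℝ ℝ (w j))
  have hUw : ∀ j, ∀ u ∈ U, u ∘ w j ∈ ratBox I := fun j u hu => Set.mem_iInter.1 hu j
  let g : K × ι → (V → ℝ) → ℝ := fun x u => branch (q x.2) (J x.2) (u ∘ w x.1)
  have hgalg : AlgebraicOn F U fun u => MvPolynomial.aeval (fun x => g x u) p :=
    AlgebraicOn.aeval (g := g) (fun x => algebraicOn_branch_comp (hq x.2) (w x.1) (hUw x.1)
      ⟨v, Set.mem_iInter.2 hvw⟩) p
  have hgan : AnalyticOnNhd ℝ (fun u => MvPolynomial.aeval (fun x => g x u) p) U :=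
    AnalyticOnNhd.aeval_mvPolynomial (f := fun u x => g x u)
      (fun x u hu => analyticAt_branch_comp (hq x.2) (w x.1) (hUw x.1 u hu)) p
  exact hgalg.eqOn_zero hU hU'.isPreconnected hgan hv (Set.mem_iInter.2 hvw) h
    (Set.mem_iInter.2 hs)

/-- A polynomial relation between algebraic functions which holds at a generic point holds
everywhere. -/
theorem aeval_branch_eq_zero {F : Subfield ℝ} {σ ι K V : Type} [Finite σ] [Finite K]
    {I : σ → ℚ × ℚ} {q : ι → (MvPolynomial σ F)[X]} {J : ι → ℚ × ℚ}
    (hq : ∀ l, IsBranch (q l) (J l) (ratBox I)) (p : MvPolynomial (K × ι) F) (w : K → σ → V)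
    {v : V → ℝ} (hv : AlgebraicIndependent F v) (hvw : ∀ j, v ∘ w j ∈ ratBox I)
    (h : MvPolynomial.aeval (fun x : K × ι => branch (q x.2) (J x.2) (v ∘ w x.1)) p = 0)
    {s : V → ℝ} (hs : ∀ j, s ∘ w j ∈ ratBox I) :
    MvPolynomial.aeval (fun x : K × ι => branch (q x.2) (J x.2) (s ∘ w x.1)) p = 0 :=
  aeval_branch_eq_zero_of_finite hq p
    (fun j i => (⟨w j i, (j, i), rfl⟩ : Set.range fun x : K × σ => w x.1 x.2))
    (hv.comp _ Subtype.val_injective) hvw h (s := s ∘ Subtype.val) hs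

theorem exists_forall_apply_eq {K σ V β : Type} [Nonempty β] {w : K → σ → V}
    (hw : ∀ j j' i i', w j i = w j' i' → i = i') (f : σ → V → β) :
    ∃ s : V → β, ∀ j i, s (w j i) = f i (w j i) := by
  classical
  refine ⟨fun u => if h : ∃ i j, w j i = u then f h.choose u else Classical.arbitrary β,
    fun j i => ?_⟩
  have h : ∃ i' j', w j' i' = w j i := ⟨i, j, rfl⟩
  obtain ⟨j', hj'⟩ := h.choose_spec
  simp only [dif_pos h]
  rw [hw _ _ _ _ hj']

/-- The intervals `I i` are pairwise disjoint. -/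
def DisjointIntervals {σ : Type} (I : σ → ℚ × ℚ) : Prop :=
  ∀ {i i' : σ} {y : ℝ}, y ∈ Set.Ioo ((I i).1 : ℝ) (I i).2 →
    y ∈ Set.Ioo ((I i').1 : ℝ) (I i').2 → i = i'

theorem DisjointIntervals.index_eq {σ K V : Type} {I : σ → ℚ × ℚ} (hI : DisjointIntervals I)
    {w : K → σ → V} {v : V → ℝ} (hvw : ∀ j, v ∘ w j ∈ ratBox I) {j j' : K} {i i' : σ}
    (h : w j i = w j' i') : i = i' :=
  hI (hvw j i) (by simpa only [Function.comp_apply, h] using hvw j' i')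

/-- If the values of the branches at `x ∘ t` cannot be obtained algebraically from fewer numbers
`x i`, then different generic arguments give different values. -/
theorem exists_branch_ne {F : Subfield ℝ} {σ ι ι' V : Type} [Fintype σ] {I : σ → ℚ × ℚ}
    (hI : DisjointIntervals I) {q : ι' → (MvPolynomial σ F)[X]} {J : ι' → ℚ × ℚ}
    (hq : ∀ l, IsBranch (q l) (J l) (ratBox I)) {x : ι → ℝ} {t : σ → ι}
    (hxt : x ∘ t ∈ ratBox I)
    (hmin : ∀ S : Finset ι, S.card < Fintype.card σ →
      ∃ l, ¬ AlgOver F (fun i : S => x i) (branch (q l) (J l) (x ∘ t)))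
    {v : V → ℝ} (hv : AlgebraicIndependent F v) {w₀ w₁ : σ → V} (hw₀ : v ∘ w₀ ∈ ratBox I)
    (hw₁ : v ∘ w₁ ∈ ratBox I) (hne : w₀ ≠ w₁) :
    ∃ l, branch (q l) (J l) (v ∘ w₀) ≠ branch (q l) (J l) (v ∘ w₁) := by
  classical
  by_contra! heq
  obtain ⟨i₀, hi₀⟩ := Function.ne_iff.1 hne
  obtain ⟨r, hr₁, hr₂⟩ := exists_rat_btwn ((hxt i₀).1.trans (hxt i₀).2)
  let w : Fin 2 → σ → V := ![w₀, w₁]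
  have hvw : ∀ j, v ∘ w j ∈ ratBox I := Fin.forall_fin_two.2 ⟨hw₀, hw₁⟩
  have hidx : ∀ j j' i i', w j i = w j' i' → i = i' := fun _ _ _ _ => hI.index_eq hvw
  obtain ⟨s, hs⟩ := exists_forall_apply_eq hidx fun i u => if u = w₀ i₀ then (r : ℝ) else x (t i)
  have hs₀ : s ∘ w₀ = Function.update (x ∘ t) i₀ r := by
    ext i
    refine (hs 0 i).trans ?_
    rcases eq_or_ne i i₀ with rfl | hi
    · simp [w]
    · rw [Function.update_of_ne hi]
      exact if_neg fun h => hi (hidx 0 0 _ _ h)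
  have hs₁ : s ∘ w₁ = x ∘ t := by
    ext i
    refine (hs 1 i).trans (if_neg fun h => hi₀ ?_)
    obtain rfl := hidx 1 0 _ _ h
    exact h.symm
  have hsw : ∀ j, s ∘ w j ∈ ratBox I := by
    refine Fin.forall_fin_two.2 ⟨?_, ?_⟩
    · change s ∘ w₀ ∈ _
      rw [hs₀]
      intro i
      rcases eq_or_ne i i₀ with rfl | hi
      · rw [Function.update_self]
        exact ⟨hr₁, hr₂⟩
      · rw [Function.update_of_ne hi]
        exact hxt i
    · change s ∘ w₁ ∈ _
      rwa [hs₁]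
  have hval : ∀ l, branch (q l) (J l) (Function.update (x ∘ t) i₀ r) =
      branch (q l) (J l) (x ∘ t) := fun l => by
    have h := aeval_branch_eq_zero hq (MvPolynomial.X (0, l) - MvPolynomial.X (1, l)) w hv hvw
      (by simpa [w, sub_eq_zero] using heq l) hsw
    rw [← hs₀, ← hs₁]
    simpa [w, sub_eq_zero] using h
  obtain ⟨l, hl⟩ := hmin ((Finset.univ.erase i₀).image t)
    (Finset.card_image_le.trans_lt (Finset.card_erase_lt_of_mem (Finset.mem_univ _)))
  let h : σ → MvPolynomial ((Finset.univ.erase i₀).image t) F := fun i =>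
    if hi : i = i₀ then MvPolynomial.C (r : F) else
      MvPolynomial.X ⟨t i, Finset.mem_image_of_mem t (Finset.mem_erase.2 ⟨hi, Finset.mem_univ _⟩)⟩
  have hh : (fun i => MvPolynomial.aeval
      (fun i : (Finset.univ.erase i₀).image t => x i) (h i)) = Function.update (x ∘ t) i₀ r := by
    ext i
    rcases eq_or_ne i i₀ with rfl | hi
    · simp [h]
    · simp [h, hi]
  have hmem : Function.update (x ∘ t) i₀ (r : ℝ) ∈ ratBox I := hs₀ ▸ hsw 0
  refine hl ⟨(q l).map (MvPolynomial.aeval h).toRingHom, ?_, ?_⟩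
  · simp only [evalAt_map_aeval, hh]
    exact (hq l).exists_evalAt_ne_zero hmem
  · rw [evalAt_map_aeval, hh, ← hval]
    exact ((hq l).branch_spec hmem).2

theorem AlgOver.of_comp {F : Subfield ℝ} {σ τ : Type} {x : τ → ℝ} {h : σ → τ} {a : ℝ}
    (ha : AlgOver F (x ∘ h) a) : AlgOver F x a := by
  obtain ⟨q, hne, h0⟩ := ha
  have key : ∀ y, evalAt (q.map (MvPolynomial.aeval fun i => MvPolynomial.X (h i) :
      MvPolynomial σ F →ₐ[F] MvPolynomial τ F).toRingHom) x y = evalAt q (x ∘ h) y := fun y => by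
    rw [evalAt_map_aeval]
    simp [Function.comp_def]
  exact ⟨_, by simpa only [key] using hne, (key a).trans h0⟩

theorem AlgOver.exists_finset {F : Subfield ℝ} {ι : Type} {x : ι → ℝ} {a : ℝ}
    (h : AlgOver F x a) : ∃ S : Finset ι, AlgOver F (fun i : S => x i) a := by
  classical
  obtain ⟨q, hne, h0⟩ := h
  let S := q.support.biUnion fun m => (q.coeff m).vars
  have hq : q ∈ lifts (MvPolynomial.aeval fun i : S => MvPolynomial.X i.1 :
      MvPolynomial S F →ₐ[F] MvPolynomial ι F).toRingHom := by
    refine (lifts_iff_coeff_lifts _).2 fun m => ?_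
    obtain ⟨c, hc⟩ := MvPolynomial.exists_rename_eq_of_vars_subset_range (q.coeff m)
      ((↑) : S → ι) Subtype.val_injective fun i hi => by
        rw [Subtype.range_coe]
        by_cases hm : q.coeff m = 0
        · simp [hm] at hi
        · exact Finset.mem_biUnion.2 ⟨m, mem_support_iff.2 hm, hi⟩
    refine ⟨c, ?_⟩
    rw [← hc, MvPolynomial.rename_eq_aeval]
    rfl
  obtain ⟨q', hq'⟩ := (mem_lifts _).1 hq
  simp only [← hq', evalAt_map_aeval, MvPolynomial.aeval_X] at hne h0
  exact ⟨S, q', hne, h0⟩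

theorem algOver_of_isAlgebraic {F : Subfield ℝ} {ι : Type} {x : ι → ℝ} {a : ℝ}
    (h : IsAlgebraic (Algebra.adjoin F (Set.range x)) a) : AlgOver F x a := by
  obtain ⟨P, hP, hPa⟩ := h
  let f : MvPolynomial ι F →+* Algebra.adjoin F (Set.range x) :=
    ((MvPolynomial.aeval x : MvPolynomial ι F →ₐ[F] ℝ).codRestrict _ fun p => by
      rw [Algebra.adjoin_range_eq_range_aeval]
      exact ⟨p, rfl⟩).toRingHom
  have hlift : P ∈ lifts f := by
    refine (lifts_iff_coeff_lifts _).2 fun m => ?_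
    obtain ⟨c, hc⟩ := (Algebra.adjoin_range_eq_range_aeval F x).le (P.coeff m).2
    exact ⟨c, Subtype.ext hc⟩
  obtain ⟨q, rfl⟩ := (mem_lifts _).1 hlift
  have key : ∀ y, evalAt q x y = aeval y (q.map f) := fun y => by
    rw [aeval_def, eval₂_map]
    rfl
  refine ⟨q, ?_, (key a).trans hPa⟩
  by_contra! h0
  refine hP ((Polynomial.map_injective (algebraMap (Algebra.adjoin F (Set.range x)) ℝ)
    Subtype.val_injective) (Polynomial.funext fun y => ?_))
  rw [Polynomial.map_zero, eval_zero, ← h0 y, key, aeval_def, eval_map]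

theorem exists_ratBox_subset {d : ℕ} {t : Fin d → ℝ} (ht : Function.Injective t)
    {U : Set (Fin d → ℝ)} (hU : U ∈ 𝓝 t) :
    ∃ I : Fin d → ℚ × ℚ, DisjointIntervals I ∧ t ∈ ratBox I ∧ ratBox I ⊆ U := by
  obtain ⟨ε, hε, hεU⟩ := Metric.mem_nhds_iff.1 hU
  have hev : ∀ᶠ δ in 𝓝[>] (0 : ℝ), ∀ i j, i ≠ j → δ + δ < |t i - t j| := by
    simp only [Filter.eventually_all]
    intro i j hij
    have h : Tendsto (fun δ : ℝ => δ + δ) (𝓝[>] 0) (𝓝 (0 + 0)) :=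
      (continuous_id.add continuous_id).continuousAt.tendsto.mono_left nhdsWithin_le_nhds
    refine h.eventually_lt_const ?_
    rw [add_zero, abs_pos, sub_ne_zero]
    exact ht.ne hij
  obtain ⟨δ, hδ, hδ0, hδε⟩ := (hev.and (Ioo_mem_nhdsGT hε)).exists
  choose l hl hl' using fun i => exists_rat_btwn (sub_lt_self (t i) hδ0)
  choose u hu hu' using fun i => exists_rat_btwn (lt_add_of_pos_right (t i) hδ0)
  have hsub : ∀ {i y}, y ∈ Set.Ioo (l i : ℝ) (u i) → |y - t i| < δ := fun {i y} hy => by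
    rw [abs_lt]
    exact ⟨by linarith [hy.1, hl i], by linarith [hy.2, hu' i]⟩
  refine ⟨fun i => (l i, u i), fun {i j y} hi hj => ?_, fun i => ⟨hl' i, hu i⟩, fun s hs => hεU ?_⟩
  · by_contra hij
    have h₁ := abs_lt.1 (hsub hi)
    have h₂ := abs_lt.1 (hsub hj)
    refine (hδ i j hij).not_ge (abs_le.2 ⟨?_, ?_⟩) <;> linarith
  · rw [Metric.mem_ball, dist_pi_lt_iff hε]
    exact fun i => (hsub (hs i)).trans hδε

/-- Numerical data describing a parametrization of points of `ℝⁿ` by algebraic functions of `d`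
variables. -/
abbrev Chart (F : Subfield ℝ) (n d : ℕ) : Type :=
  (Fin d → ℚ × ℚ) × (Fin n → (MvPolynomial (Fin d) F)[X] × ℚ × ℚ)

/-- The parametrization given by a chart. -/
noncomputable def Chart.param {F : Subfield ℝ} {n d : ℕ} (c : Chart F n d) (s : Fin d → ℝ) :
    Fin n → ℝ :=
  fun l => branch (c.2 l).1 (c.2 l).2 s

/-- The intervals of the domain are disjoint, and the parametrization is well-defined on it. -/
structure Chart.IsRegular {F : Subfield ℝ} {n d : ℕ} (c : Chart F n d) : Prop where
  disjointIntervals : DisjointIntervals c.1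
  isBranch : ∀ l, IsBranch (c.2 l).1 (c.2 l).2 (ratBox c.1)

/-- `a` is the value of the parametrization at `x ∘ t`, and it does not depend algebraically on
fewer numbers `x i`. -/
structure Chart.Represents {F : Subfield ℝ} {n d : ℕ} (c : Chart F n d) {ι : Type} (x : ι → ℝ)
    (t : Fin d → ι) (a : Fin n → ℝ) : Prop where
  isRegular : c.IsRegular
  mem_ratBox : x ∘ t ∈ ratBox c.1
  eq_param : a = c.param (x ∘ t)
  minimal : ∀ S : Finset ι, S.card < d → ∃ l, ¬ AlgOver F (fun i : S => x i) (a l)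

theorem Chart.exists_represents {F : Subfield ℝ} {ι : Type} {x : ι → ℝ}
    (hx : Function.Injective x) (halg : ∀ a, AlgOver F x a) {n : ℕ} (a : Fin n → ℝ) :
    ∃ (d : ℕ) (c : Chart F n d) (t : Fin d → ι), c.Represents x t a := by
  classical
  have hex : ∃ (d : ℕ) (S : Finset ι), S.card = d ∧ ∀ l, AlgOver F (fun i : S => x i) (a l) := by
    choose S hS using fun l => (halg (a l)).exists_finset
    refine ⟨_, Finset.univ.biUnion S, rfl, fun l => ?_⟩
    exact AlgOver.of_comp (x := fun i : Finset.univ.biUnion S => x i)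
      (h := fun i : S l => ⟨i, Finset.mem_biUnion.2 ⟨l, Finset.mem_univ l, i.2⟩⟩) (hS l)
  obtain ⟨S, hSd, hS⟩ := Nat.find_spec hex
  set d := Nat.find hex
  let e : S ≃ Fin d := S.equivFinOfCardEq hSd
  let t : Fin d → ι := fun i => e.symm i
  have ht : Function.Injective t := Subtype.val_injective.comp e.symm.injective
  have hat : ∀ l, AlgOver F (x ∘ t) (a l) := fun l =>
    AlgOver.of_comp (h := e) (by simpa [Function.comp_def, t] using hS l)
  choose q hq hq' using fun l => (hat l).exists_simple_root
  choose J haJ U hU hUq using fun l => exists_isBranch (hq l) (hq' l)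
  obtain ⟨I, hI, hIt, hIU⟩ := exists_ratBox_subset (hx.comp ht) (Filter.iInter_mem.2 hU)
  have hbr : ∀ l, IsBranch (q l) (J l) (ratBox I) := fun l =>
    (hUq l).mono (hIU.trans (Set.iInter_subset U l))
  refine ⟨d, (I, fun l => (q l, J l)), t, ⟨hI, hbr⟩, hIt,
    funext fun l => (hbr l).eq_branch hIt (haJ l) (hq l), fun S' hS' => ?_⟩
  by_contra! h
  exact Nat.find_min hex hS' ⟨S', rfl, h⟩

theorem Chart.countable {F : Subfield ℝ} [Countable F] {n d : ℕ} : Countable (Chart F n d) := by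
  have h₁ : Countable (MvPolynomial (Fin d) F) :=
    Cardinal.mk_le_aleph0_iff.1 (MvPolynomial.cardinalMk_le_max.trans (by simp))
  have h₂ : Countable (MvPolynomial (Fin d) F)[X] :=
    Cardinal.mk_le_aleph0_iff.1 (Polynomial.cardinalMk_le_max.trans (by simp))
  infer_instance

theorem AlgebraicIndependent.add_algebraMap {F : Subfield ℝ} {V : Type} {y : V → ℝ}
    (hy : AlgebraicIndependent F y) (ρ : V → F) : AlgebraicIndependent F fun v => y v + ρ v := by
  let f : MvPolynomial V F →ₐ[F] MvPolynomial V F :=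
    MvPolynomial.aeval fun v => MvPolynomial.X v + MvPolynomial.C (ρ v)
  let g : MvPolynomial V F →ₐ[F] MvPolynomial V F :=
    MvPolynomial.aeval fun v => MvPolynomial.X v - MvPolynomial.C (ρ v)
  have hgf : g.comp f = AlgHom.id F _ := by
    ext v
    simp [f, g, MvPolynomial.algHom_C]
  have hf : Function.Injective f :=
    Function.LeftInverse.injective (g := g) fun p => DFunLike.congr_fun hgf p
  have haeval : (MvPolynomial.aeval fun v => y v + ρ v : MvPolynomial V F →ₐ[F] ℝ) =
      (MvPolynomial.aeval y).comp f := by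
    ext v
    simp [f]
    rfl
  rw [AlgebraicIndependent, haeval]
  exact Function.Injective.comp (g := MvPolynomial.aeval y) hy hf

theorem exists_algebraicIndependent_mem_Ioo {F : Subfield ℝ} [Countable F] {d : ℕ}
    {I : Fin d → ℚ × ℚ} (hI : ∀ i, ((I i).1 : ℝ) < (I i).2) :
    ∃ y : Fin d × ℝ → ℝ, AlgebraicIndependent F y ∧
      ∀ v, y v ∈ Set.Ioo ((I v.1).1 : ℝ) (I v.1).2 := by
  obtain ⟨ι, x, hx⟩ := exists_isTranscendenceBasis' F ℝ
  have hι : #(Fin d × ℝ) ≤ #ι := by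
    have hF : #F ≤ ℵ₀ := Cardinal.mk_le_aleph0
    have hle : #(Fin d × ℝ) ≤ Cardinal.continuum := by
      rw [Cardinal.mk_prod, Cardinal.lift_id, Cardinal.lift_id, Cardinal.mk_real]
      exact Cardinal.mul_le_of_le Cardinal.aleph0_le_continuum
        (Cardinal.mk_le_aleph0.trans Cardinal.aleph0_le_continuum) le_rfl
    refine hle.trans ?_
    by_contra! hlt
    have hlt' : max (max #F #ι) ℵ₀ < Cardinal.continuum :=
      max_lt (max_lt (hF.trans_lt Cardinal.aleph0_lt_continuum) hlt) Cardinal.aleph0_lt_continuum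
    cases isEmpty_or_nonempty ι
    · have := hx.isEmpty_iff_isAlgebraic.1 inferInstance
      have h := Algebra.IsAlgebraic.cardinalMk_le_max F ℝ
      rw [Cardinal.mk_real, max_eq_right hF] at h
      exact h.not_gt Cardinal.aleph0_lt_continuum
    · have h := hx.lift_cardinalMk_eq_max_lift
      simp only [Cardinal.lift_id, Cardinal.mk_real] at h
      exact hlt'.ne' h
  obtain ⟨e⟩ := hι
  have hρ : ∀ v : Fin d × ℝ, ∃ ρ : ℚ, x (e v) + ρ ∈ Set.Ioo ((I v.1).1 : ℝ) (I v.1).2 := fun v => by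
    obtain ⟨ρ, h₁, h₂⟩ := exists_rat_btwn (sub_lt_sub_right (hI v.1) (x (e v)))
    exact ⟨ρ, by linarith, by linarith⟩
  choose ρ hρ using hρ
  refine ⟨fun v => x (e v) + (ρ v : F), (hx.1.comp _ e.injective).add_algebraMap _, fun v => ?_⟩
  simpa using hρ v

open Classical in
theorem Chart.exists_monochromatic_zero {F : Subfield ℝ} [Countable F] {k n d : ℕ} (hk : 0 < k)
    {κ : Cardinal} (hκ : ℵ₀ ≤ κ) (hc : cardSucc κ (k - 1) ≤ Cardinal.continuum)
    {p : MvPolynomial (Fin k × Fin n) F} {ι : Type} {x : ι → ℝ} (hx : AlgebraicIndependent F x)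
    {c : Chart F n d} {t : Fin k → Fin d → ι} {a : Fin k → Fin n → ℝ}
    (hta : ∀ j, c.Represents x (t j) (a j)) (ha : Function.Injective a)
    (hp : MvPolynomial.aeval (fun z : Fin k × Fin n => a z.1 z.2) p = 0)
    {α : Type} (hα : #α ≤ κ) (φ : (Fin n → ℝ) → α) :
    ∃ b : Fin k → Fin n → ℝ, Function.Injective b ∧
      MvPolynomial.aeval (fun z : Fin k × Fin n => b z.1 z.2) p = 0 ∧ ∃ r, ∀ j, φ (b j) = r := by
  let j₀ : Fin k := ⟨0, hk⟩
  obtain ⟨hdisj, hbr⟩ := (hta j₀).isRegular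
  have htinj : Function.Injective t := fun j j' h => ha <| by
    rw [(hta j).eq_param, (hta j').eq_param, h]
  obtain ⟨I, hIcard, hI⟩ := exists_separating_coordinates (Finset.univ.image t)
    ⟨t j₀, Finset.mem_image_of_mem t (Finset.mem_univ _)⟩
  have hIk : I.card ≤ k - 1 := by
    have := hIcard.trans_le Finset.card_image_le
    rw [Finset.card_fin] at this
    omega
  obtain ⟨y, hy, hyI⟩ := exists_algebraicIndependent_mem_Ioo (F := F) (I := c.1) fun i =>
    ((hta j₀).mem_ratBox i).1.trans ((hta j₀).mem_ratBox i).2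
  let pt : (Fin I.card → ℝ) → Fin d → Fin d × ℝ := fun ρ i =>
    (i, if h : i ∈ I then ρ (I.equivFin ⟨i, h⟩) else 0)
  have hpt : ∀ ρ, y ∘ pt ρ ∈ ratBox c.1 := fun ρ i => hyI (pt ρ i)
  let L := Set.range fun z : Fin k × Fin d => t z.1 z.2
  obtain ⟨g, r, hg, hr⟩ := exists_monochromatic_grid hκ hα (L := L) I.card (X := ℝ)
    (((monotone_cardSucc κ hIk).trans hc).trans_eq Cardinal.mk_real.symm)
    fun ρ => φ (c.param (y ∘ pt ρ))
  let w : Fin k → Fin d → L := fun j i => ⟨t j i, (j, i), rfl⟩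
  have hw : ∀ j, (x ∘ Subtype.val) ∘ w j ∈ ratBox c.1 := fun j => (hta j).mem_ratBox
  obtain ⟨s, hs⟩ := exists_forall_apply_eq (w := w) (fun _ _ _ _ => hdisj.index_eq hw)
    fun i u => y (i, if h : i ∈ I then g (I.equivFin ⟨i, h⟩) u else 0)
  let ρ : Fin k → Fin I.card → ℝ := fun j m => g m (w j (I.equivFin.symm m))
  have hsw : ∀ j, s ∘ w j = y ∘ pt (ρ j) := fun j => by
    ext i
    refine (hs j i).trans ?_
    by_cases hi : i ∈ I <;> simp [pt, ρ, hi]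
  refine ⟨fun j => c.param (s ∘ w j), fun j j' hjj' => ?_, ?_, r, fun j => ?_⟩
  · by_contra hne
    obtain ⟨i, hi, hti⟩ := hI (t j) (Finset.mem_image_of_mem t (Finset.mem_univ _)) (t j')
      (Finset.mem_image_of_mem t (Finset.mem_univ _)) (htinj.ne hne)
    have hρ : pt (ρ j) ≠ pt (ρ j') := fun h => by
      have h := congrFun h i
      simp only [pt, ρ, hi, dif_pos, Prod.mk.injEq, true_and, Equiv.symm_apply_apply] at h
      exact hti (congrArg Subtype.val (hg _ h))
    obtain ⟨l, hl⟩ := exists_branch_ne hdisj hbr (hta j₀).mem_ratBox (fun S hS => by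
      obtain ⟨l, hl⟩ := (hta j₀).minimal S (by simpa using hS)
      rw [(hta j₀).eq_param] at hl
      exact ⟨l, hl⟩) hy (hpt (ρ j)) (hpt (ρ j')) hρ
    rw [← hsw, ← hsw] at hl
    exact hl (congrFun hjj' l)
  · refine aeval_branch_eq_zero hbr p w (hx.comp _ Subtype.val_injective) hw ?_ fun j =>
      hsw j ▸ hpt (ρ j)
    rw [← hp]
    congr 2
    ext z
    rw [(hta z.1).eq_param]
    rfl
  · simp only [hsw]
    exact hr fun m => w j (I.equivFin.symm m)

theorem hgColorable_aleph0_of_subfield {F : Subfield ℝ} [Countable F] {k n : ℕ} (hk : 0 < k)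
    {κ : Cardinal} (hκ : ℵ₀ ≤ κ) (hc : cardSucc κ (k - 1) ≤ Cardinal.continuum)
    {p : MvPolynomial (Fin k × Fin n) F}
    (h : HGColorable (zeroEdges (p.map (algebraMap F ℝ))) κ) :
    HGColorable (zeroEdges (p.map (algebraMap F ℝ))) ℵ₀ := by
  obtain ⟨ι, x, hx⟩ := exists_isTranscendenceBasis' F ℝ
  have halg := hx.isAlgebraic
  have hchart : ∀ a : Fin n → ℝ, ∃ c : Σ d, Chart F n d, ∃ t, c.2.Represents x t a := fun a => by
    obtain ⟨d, c, t, h⟩ := Chart.exists_represents hx.1.injective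
      (fun a => algOver_of_isAlgebraic (halg.isAlgebraic a)) a
    exact ⟨⟨d, c⟩, t, h⟩
  choose c hcr using hchart
  have : ∀ d, Countable (Chart F n d) := fun d => Chart.countable
  refine ⟨Σ d, Chart F n d, c, Cardinal.mk_le_aleph0, ?_⟩
  rintro _ ⟨a, ha, rfl, hp⟩
  by_contra! hmono
  obtain ⟨α, φ, hα, hφ⟩ := h
  have hca : ∀ j, ∃ t, (c (a ⟨0, hk⟩)).2.Represents x t (a j) := fun j => by
    rw [hmono _ ⟨⟨0, hk⟩, rfl⟩ _ ⟨j, rfl⟩]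
    exact hcr (a j)
  choose t ht using hca
  simp only [MvPolynomial.eval_map] at hp
  obtain ⟨b, hb, hpb, r, hr⟩ := Chart.exists_monochromatic_zero hk hκ hc hx.1 ht ha
    (by rwa [MvPolynomial.aeval_def]) hα φ
  obtain ⟨_, ⟨j, rfl⟩, _, ⟨j', rfl⟩, hne⟩ := hφ _ ⟨b, hb, rfl, by
    rwa [MvPolynomial.eval_map, ← MvPolynomial.aeval_def]⟩
  exact hne (by rw [hr, hr])

theorem exists_countable_subfield {σ : Type} (p : MvPolynomial σ ℝ) :
    ∃ F : Subfield ℝ, Countable F ∧ ∃ p' : MvPolynomial σ F, p = p'.map (algebraMap F ℝ) := by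
  refine ⟨Subfield.closure (p.coeffs : Set ℝ), ?_, ?_⟩
  · refine Cardinal.mk_le_aleph0_iff.1 ((Subfield.cardinalMk_closure_le_max _).trans ?_)
    simp
  · obtain ⟨p', hp'⟩ := (MvPolynomial.mem_range_map_iff_coeffs_subset
      (f := algebraMap (Subfield.closure (p.coeffs : Set ℝ)) ℝ)).2 fun r hr =>
        ⟨⟨r, Subfield.subset_closure hr⟩, rfl⟩
    exact ⟨p', hp'.symm⟩

theorem hgColorable_aleph0 {k n : ℕ} (hk : 0 < k) {κ : Cardinal} (hκ : ℵ₀ ≤ κ)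
    (hc : cardSucc κ (k - 1) ≤ Cardinal.continuum) {p : MvPolynomial (Fin k × Fin n) ℝ}
    (h : HGColorable (zeroEdges p) κ) : HGColorable (zeroEdges p) ℵ₀ := by
  obtain ⟨F, hF, p, rfl⟩ := exists_countable_subfield p
  exact hgColorable_aleph0_of_subfield hk hκ hc h

end AlgebraicFunctions

/-- Corollary 2.3: there is an algebraic `k`-hypergraph on
some `ℝⁿ` with chromatic number `κ` iff `1 ≤ κ ≤ ℵ₀` or
`κ ≤ 2^{ℵ₀} ≤ κ^{+(k-2)}`. -/
theorem statement2 (k : ℕ) (hk : 2 ≤ k) (κ : Cardinal) :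
    (∃ n : ℕ, 1 ≤ n ∧ ∃ p : MvPolynomial (Fin k × Fin n) ℝ,
        chrNum (zeroEdges p) = κ) ↔
      ((1 ≤ κ ∧ κ ≤ Cardinal.aleph0) ∨
        (κ ≤ Cardinal.continuum ∧ Cardinal.continuum ≤ cardSucc κ (k - 2))) := by
  constructor
  · rintro ⟨n, -, p, rfl⟩
    have hcol := hgColorable_chrNum_zeroEdges hk p
    rcases le_or_gt (chrNum (zeroEdges p)) ℵ₀ with h | h
    · exact Or.inl ⟨one_le_of_hgColorable hcol, h⟩
    · refine Or.inr ⟨csInf_le' (hgColorable_zeroEdges_continuum hk p), ?_⟩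
      by_contra! hlt
      refine h.not_ge (csInf_le' (hgColorable_aleph0 (by omega) h.le ?_ hcol))
      rw [show k - 1 = k - 2 + 1 by omega, cardSucc_succ]
      exact Order.succ_le_of_lt hlt
  · intro h
    rcases le_or_gt κ ℵ₀ with hκ | hκ
    · have h1 : κ ≠ 0 := by
        rintro rfl
        rcases h with h | h
        · simpa using h.1
        · exact (h.2.trans_lt (cardSucc_lt_aleph0 Cardinal.aleph0_pos _)).not_ge
            Cardinal.aleph0_le_continuum
      rcases hκ.lt_or_eq with hlt | rfl
      · obtain ⟨m, rfl⟩ := Cardinal.lt_aleph0.1 hlt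
        obtain ⟨m, rfl⟩ := Nat.exists_eq_succ_of_ne_zero (Nat.cast_ne_zero.1 h1)
        exact ⟨1, le_rfl, exists_chrNum_eq_natCast hk m⟩
      · exact ⟨3, by norm_num, exists_chrNum_eq_aleph0 hk⟩
    · obtain ⟨hle, hge⟩ := h.resolve_left fun h => h.2.not_gt hκ
      classical
      have hex : ∃ j, Cardinal.continuum ≤ cardSucc κ j := ⟨_, hge⟩
      have hj : Nat.find hex ≤ k - 2 := Nat.find_min' hex hge
      refine ⟨Nat.find hex + 1, by omega,
        exists_chrNum_eq_of_continuum_eq_cardSucc (by omega) hκ ((Nat.find_spec hex).antisymm ?_)⟩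
      cases hm : Nat.find hex with
      | zero => exact hle
      | succ m =>
        rw [cardSucc_succ]
        exact Order.succ_le_of_lt (not_le.1 (Nat.find_min hex (hm ▸ m.lt_succ_self)))
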